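/- arXiv:1509.08550 — 2 statements merged into one kernel-verified Lean document; each statement's English description precedes it below -/
import Mathlib

section
/- Euler element: fix a basis y₁,…,y_n of h with dual basis x₁,…,x_n of h*, and for s ∈ S let λ_s be the eigenvalue of s on h* different from 1. Then the element h := Σ_{i=1}^n x_i y_i + n/2 − Σ_{s∈S} (2c(s)/(1−λ_s)) s of H_c satisfies [h,x] = x for all x ∈ h*, [h,y] = −y for all y ∈ h, and [h,w] = 0 for all w ∈ W. -/
/-! Core definitions: complex reflection groups, rational Cherednik algebras,
and their categories 𝒪. -/

noncomputable section

open Module Function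

/-- A (complex) reflection: a linear automorphism `g` with `rank (g - 1) = 1`. -/
def IsComplexReflection {V : Type} [AddCommGroup V] [Module ℂ V]
    (g : V ≃ₗ[ℂ] V) : Prop :=
  Module.finrank ℂ (LinearMap.range (g.toLinearMap - LinearMap.id)) = 1

variable (V : Type) [AddCommGroup V] [Module ℂ V] [FiniteDimensional ℂ V]

/-- A finite complex reflection group on a finite dimensional complex vector
space `V`: a finite subgroup of `GL(V)` generated by its reflections. -/
structure CRG where
  W : Subgroup (V ≃ₗ[ℂ] V)
  finite : Finite W
  gen : Subgroup.closure {g : V ≃ₗ[ℂ] V | g ∈ W ∧ IsComplexReflection g} = W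

variable {V}

/-- The set `S` of reflections in `W`. -/
def CRG.Refl (G : CRG V) : Type :=
  {s : G.W // IsComplexReflection (s : V ≃ₗ[ℂ] V)}

instance (G : CRG V) : CoeOut G.Refl G.W := ⟨fun s => s.1⟩

/-- Conjugation invariance of a parameter `c : S → ℂ`. -/
def IsConjInvariant {G : CRG V} (c : G.Refl → ℂ) : Prop :=
  ∀ s t : G.Refl, (∃ g : G.W, t.1 = g * s.1 * g⁻¹) → c t = c s

/-- For each reflection `s`: eigenvectors `α_s ∈ h*`, `α_s^∨ ∈ h` for `s` with
eigenvalue different from `1`, normalized by `⟨α_s, α_s^∨⟩ = 2`; `lam s` is the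
eigenvalue of `s` on `h*` different from `1`. -/
structure ReflData (G : CRG V) where
  α : G.Refl → Module.Dual ℂ V
  αv : G.Refl → V
  lam : G.Refl → ℂ
  lam_ne_one : ∀ s, lam s ≠ 1
  α_ne : ∀ s, α s ≠ 0
  αv_ne : ∀ s, αv s ≠ 0
  eig_α : ∀ (s : G.Refl) (v : V),
    α s (((s.1 : V ≃ₗ[ℂ] V)).symm v) = lam s * α s v
  eig_αv : ∀ s : G.Refl, ∃ μ : ℂ, μ ≠ 1 ∧ ((s.1 : V ≃ₗ[ℂ] V)) (αv s) = μ • αv s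
  pairing : ∀ s, α s (αv s) = 2

/-- The rational Cherednik algebra `H_c(W)`: the quotient of `T(h ⊕ h*)#W` by
the commutation relations, presented via its universal property. -/
structure RCA (G : CRG V) (D : ReflData G) (c : G.Refl → ℂ) where
  H : Type
  [ring : Ring H]
  [alg : Algebra ℂ H]
  x : Module.Dual ℂ V →ₗ[ℂ] H
  y : V →ₗ[ℂ] H
  w : G.W →* H
  comm_x : ∀ a b, x a * x b = x b * x a
  comm_y : ∀ u v, y u * y v = y v * y u
  w_x : ∀ (g : G.W) (a : Module.Dual ℂ V),
    w g * x a = x (a ∘ₗ (((g⁻¹ : G.W) : V ≃ₗ[ℂ] V) : V →ₗ[ℂ] V)) * w g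
  w_y : ∀ (g : G.W) (v : V), w g * y v = y (((g : V ≃ₗ[ℂ] V)) v) * w g
  rel : ∀ (v : V) (a : Module.Dual ℂ V),
    y v * x a - x a * y v =
      algebraMap ℂ H (a v) -
        ∑ᶠ s : G.Refl, (c s * D.α s v * a (D.αv s)) • w s.1
  universal : ∀ (A : Type) [Ring A] [Algebra ℂ A]
      (xA : Module.Dual ℂ V →ₗ[ℂ] A) (yA : V →ₗ[ℂ] A) (wA : G.W →* A),
      (∀ a b, xA a * xA b = xA b * xA a) →
      (∀ u v, yA u * yA v = yA v * yA u) →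
      (∀ (g : G.W) (a : Module.Dual ℂ V),
        wA g * xA a = xA (a ∘ₗ (((g⁻¹ : G.W) : V ≃ₗ[ℂ] V) : V →ₗ[ℂ] V)) * wA g) →
      (∀ (g : G.W) (v : V), wA g * yA v = yA (((g : V ≃ₗ[ℂ] V)) v) * wA g) →
      (∀ (v : V) (a : Module.Dual ℂ V),
        yA v * xA a - xA a * yA v =
          algebraMap ℂ A (a v) -
            ∑ᶠ s : G.Refl, (c s * D.α s v * a (D.αv s)) • wA s.1) →
      ∃! φ : H →ₐ[ℂ] A,
        (∀ a, φ (x a) = xA a) ∧ (∀ v, φ (y v) = yA v) ∧ (∀ g, φ (w g) = wA g)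

attribute [instance] RCA.ring RCA.alg

variable {G : CRG V} {D : ReflData G} {c : G.Refl → ℂ}

/-- The category `𝒪_c(W)`: modules over `H_c` which are finitely generated and
on which `h` acts locally nilpotently. -/
structure CatO (R : RCA G D c) where
  M : Type
  [ab : AddCommGroup M]
  [mod : Module R.H M]
  locNilp : ∀ m : M, ∃ N : ℕ, ∀ L : List V, L.length = N →
    (L.map fun v => R.y v).prod • m = 0
  fg : Module.Finite R.H M

attribute [instance] CatO.ab CatO.mod

instance catO (R : RCA G D c) : CategoryTheory.Category (CatO R) where
  Hom A B := A.M →ₗ[R.H] B.M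
  id A := LinearMap.id
  comp f g := g.comp f
  id_comp f := LinearMap.comp_id f
  comp_id f := LinearMap.id_comp f
  assoc f g h := (LinearMap.comp_assoc _ _ _).symm

/-- A finite dimensional representation of `W`. -/
structure WRep (G : CRG V) where
  T : Type
  [ab : AddCommGroup T]
  [mod : Module ℂ T]
  [fd : FiniteDimensional ℂ T]
  ρ : G.W →* (T ≃ₗ[ℂ] T)

attribute [instance] WRep.ab WRep.mod WRep.fd

/-- Irreducibility of a representation of `W`. -/
def WRep.IsIrr {G : CRG V} (τ : WRep G) : Prop :=
  Nontrivial τ.T ∧ ∀ U : Submodule ℂ τ.T,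
    (∀ (g : G.W) (t : τ.T), t ∈ U → τ.ρ g t ∈ U) → U = ⊥ ∨ U = ⊤

/-- Isomorphism of representations of `W`. -/
def WRep.Iso {G : CRG V} (τ τ' : WRep G) : Prop :=
  ∃ e : τ.T ≃ₗ[ℂ] τ'.T, ∀ (g : G.W) (t : τ.T), e (τ.ρ g t) = τ'.ρ g (e t)

/-- `M`, together with the lowest weight inclusion `ι : τ → M`, is the Verma
module `Δ_c(τ) = H_c ⊗_{S(h)#W} τ`, presented via its universal property. -/
structure VermaStr (R : RCA G D c) (τ : WRep G) (M : Type) [AddCommGroup M]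
    [Module R.H M] where
  ι : τ.T →+ M
  ι_smul : ∀ (a : ℂ) (t : τ.T), ι (a • t) = algebraMap ℂ R.H a • ι t
  ι_y : ∀ (v : V) (t : τ.T), R.y v • ι t = 0
  ι_w : ∀ (g : G.W) (t : τ.T), R.w g • ι t = ι (τ.ρ g t)
  universal : ∀ (N : Type) [AddCommGroup N] [Module R.H N] (κ : τ.T →+ N),
      (∀ (a : ℂ) (t : τ.T), κ (a • t) = algebraMap ℂ R.H a • κ t) →
      (∀ (v : V) (t : τ.T), R.y v • κ t = 0) →
      (∀ (g : G.W) (t : τ.T), R.w g • κ t = κ (τ.ρ g t)) →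
      ∃! φ : M →ₗ[R.H] N, ∀ t, φ (ι t) = κ t

/-- A greatest proper submodule (so the quotient is the unique simple
quotient). -/
def IsGreatestProper {A : Type} [Ring A] {M : Type} [AddCommGroup M]
    [Module A M] (N : Submodule A M) : Prop :=
  N ≠ ⊤ ∧ ∀ N' : Submodule A M, N' ≠ ⊤ → N' ≤ N

end

section Euler
noncomputable section

variable {V : Type} [AddCommGroup V] [Module ℂ V] [FiniteDimensional ℂ V]
variable {G : CRG V} {D : ReflData G} {c : G.Refl → ℂ}

open Module

/-- The Euler element `h = Σ x_i y_i + n/2 − Σ_s (2c(s)/(1−λ_s)) s` of `H_c`. -/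
def eulerElt (R : RCA G D c) {n : ℕ} (b : Basis (Fin n) ℂ V) : R.H :=
  (∑ i, R.x (b.coord i) * R.y (b i)) + ((n : ℂ) / 2) • (1 : R.H)
    - ∑ᶠ s : G.Refl, (2 * c s / (1 - D.lam s)) • R.w s.1

/-- The inverse of a reflection is `v ↦ v + (λ_s - 1)/2 ⟨α_s, v⟩ α_s^∨`. -/
theorem ReflData.symm_apply (D : ReflData G) (s : G.Refl) (v : V) :
    (s.1 : V ≃ₗ[ℂ] V).symm v = v + ((D.lam s - 1) / 2 * D.α s v) • D.αv s := by
  obtain ⟨μ, hμ, hs⟩ := D.eig_αv s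
  have hrange : ∀ u : V, ∃ k : ℂ, k • D.αv s = (s.1 : V ≃ₗ[ℂ] V) u - u := by
    intro u
    have hmem : D.αv s ∈
        LinearMap.range ((s.1 : V ≃ₗ[ℂ] V).toLinearMap - LinearMap.id) := by
      refine ⟨(μ - 1)⁻¹ • D.αv s, ?_⟩
      have h1 : μ - 1 ≠ 0 := sub_ne_zero.mpr hμ
      simp only [LinearMap.sub_apply, LinearEquiv.coe_coe, LinearMap.id_apply, map_smul, hs]
      rw [inv_smul_eq_iff₀ h1, sub_smul, one_smul]
    obtain ⟨k, hk⟩ := exists_smul_eq_of_finrank_eq_one s.2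
      (x := ⟨D.αv s, hmem⟩) (by simpa [Subtype.ext_iff] using D.αv_ne s)
      ⟨(s.1 : V ≃ₗ[ℂ] V) u - u, ⟨u, by simp⟩⟩
    exact ⟨k, by simpa [Subtype.ext_iff] using hk⟩
  obtain ⟨k, hk⟩ := hrange ((s.1 : V ≃ₗ[ℂ] V).symm v)
  rw [LinearEquiv.apply_symm_apply] at hk
  have hα := congrArg (D.α s) hk
  rw [map_smul, map_sub, D.pairing, D.eig_α, smul_eq_mul] at hα
  have hk' : k = -((D.lam s - 1) / 2 * D.α s v) := by linear_combination hα / 2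
  rw [hk', neg_smul] at hk
  rw [← sub_eq_iff_eq_add', ← neg_sub, ← hk, neg_neg]

/-- Conjugate reflections have the same nontrivial eigenvalue. -/
theorem ReflData.lam_conj (D : ReflData G) {s t : G.Refl} (g : G.W)
    (h : t.1 = g * s.1 * g⁻¹) : D.lam t = D.lam s := by
  have hs : (s.1 : V ≃ₗ[ℂ] V).symm (D.αv s) = D.lam s • D.αv s := by
    rw [D.symm_apply, D.pairing]
    module
  set u : V := (g : V ≃ₗ[ℂ] V) (D.αv s) with hu
  have ht : (t.1 : V ≃ₗ[ℂ] V).symm u = D.lam s • u := by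
    rw [LinearEquiv.symm_apply_eq, h]
    have h1 : ((g * s.1 * g⁻¹ : G.W) : V ≃ₗ[ℂ] V) (D.lam s • u) =
        (g : V ≃ₗ[ℂ] V) ((s.1 : V ≃ₗ[ℂ] V) ((g : V ≃ₗ[ℂ] V).symm (D.lam s • u))) := rfl
    rw [h1, map_smul, hu, LinearEquiv.symm_apply_apply, ← hs, LinearEquiv.apply_symm_apply]
  have hα := D.eig_α t u
  rw [ht, map_smul, smul_eq_mul] at hα
  refine (mul_right_cancel₀ (fun h0 => ?_) hα).symm
  have hfix := D.symm_apply t u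
  rw [ht, h0, mul_zero, zero_smul, add_zero] at hfix
  have hz : (D.lam s - 1) • u = 0 := by rw [sub_smul, hfix, one_smul, sub_self]
  rcases smul_eq_zero.mp hz with h2 | h2
  · exact D.lam_ne_one s (sub_eq_zero.mp h2)
  · exact D.αv_ne s ((LinearEquiv.map_eq_zero_iff _).mp h2)

instance CRG.finite_refl (G : CRG V) : Finite G.Refl :=
  haveI := G.finite
  inferInstanceAs (Finite {s : G.W // IsComplexReflection (s : V ≃ₗ[ℂ] V)})

/-- Conjugation by an element of `W`, as a permutation of the reflections. -/
def CRG.conjRefl (G : CRG V) (g : G.W) : G.Refl ≃ G.Refl :=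
  (MulAut.conj g).toEquiv.subtypeEquiv fun s => by
    have h : (((MulAut.conj g) s : G.W) : V ≃ₗ[ℂ] V).toLinearMap - LinearMap.id =
        (g : V ≃ₗ[ℂ] V).toLinearMap ∘ₗ ((s : V ≃ₗ[ℂ] V).toLinearMap - LinearMap.id) ∘ₗ
          (g : V ≃ₗ[ℂ] V).symm.toLinearMap := by
      ext v
      simp
    change IsComplexReflection _ ↔
      IsComplexReflection (((MulAut.conj g) s : G.W) : V ≃ₗ[ℂ] V)
    unfold IsComplexReflection
    rw [h, LinearMap.range_comp, LinearMap.range_comp_of_range_eq_top _ (LinearEquiv.range _)]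
    rw [LinearEquiv.finrank_map_eq (g : V ≃ₗ[ℂ] V)]

theorem CRG.coe_conjRefl (G : CRG V) (g : G.W) (s : G.Refl) :
    (G.conjRefl g s).1 = g * s.1 * g⁻¹ := rfl

namespace RCA

/-- The commutator of a reflection with an element of `h*`. -/
theorem w_mul_x_sub (R : RCA G D c) (s : G.Refl) (a : Module.Dual ℂ V) :
    R.w s.1 * R.x a - R.x a * R.w s.1 =
      ((D.lam s - 1) / 2 * a (D.αv s)) • (R.x (D.α s) * R.w s.1) := by
  have h : a ∘ₗ (((s.1⁻¹ : G.W) : V ≃ₗ[ℂ] V) : V →ₗ[ℂ] V) =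
      a + ((D.lam s - 1) / 2 * a (D.αv s)) • D.α s := by
    ext v
    have h1 : ((s.1⁻¹ : G.W) : V ≃ₗ[ℂ] V) v = (s.1 : V ≃ₗ[ℂ] V).symm v := rfl
    simp only [LinearMap.comp_apply, LinearEquiv.coe_coe, h1, D.symm_apply, map_add, map_smul,
      LinearMap.add_apply, LinearMap.smul_apply, smul_eq_mul]
    ring
  rw [R.w_x, h, map_add, map_smul, add_mul, add_sub_cancel_left, smul_mul_assoc]

/-- The commutator of a reflection with an element of `h`. -/
theorem w_mul_y_sub (R : RCA G D c) (s : G.Refl) (v : V) :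
    R.w s.1 * R.y v - R.y v * R.w s.1 =
      ((1 - D.lam s) / 2 * D.α s v) • (R.w s.1 * R.y (D.αv s)) := by
  have h : R.y v * R.w s.1 = R.w s.1 * R.y ((s.1 : V ≃ₗ[ℂ] V).symm v) := by
    rw [R.w_y, LinearEquiv.apply_symm_apply]
  rw [h, D.symm_apply, map_add, map_smul, mul_add, mul_smul_comm]
  module

/-- The canonical element `Σ x_i y_i` commutes with `W`. -/
theorem sum_x_mul_y_mul_w (R : RCA G D c) {n : ℕ} (b : Basis (Fin n) ℂ V) (g : G.W) :
    R.w g * ∑ i, R.x (b.coord i) * R.y (b i) =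
      (∑ i, R.x (b.coord i) * R.y (b i)) * R.w g := by
  have hy : ∀ v, R.y v = ∑ j, b.coord j v • R.y (b j) := fun v => by
    conv_lhs => rw [← b.sum_repr v, map_sum]
    simp
  have hx : ∀ j, ∑ i, b.coord j ((g : V ≃ₗ[ℂ] V) (b i)) •
      (b.coord i ∘ₗ (((g⁻¹ : G.W) : V ≃ₗ[ℂ] V) : V →ₗ[ℂ] V)) = b.coord j := by
    intro j
    ext v
    have h1 : ((g⁻¹ : G.W) : V ≃ₗ[ℂ] V) v = (g : V ≃ₗ[ℂ] V).symm v := rfl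
    have h2 := congrArg (fun u => b.coord j ((g : V ≃ₗ[ℂ] V) u))
      (b.sum_repr ((g : V ≃ₗ[ℂ] V).symm v))
    simp only [map_sum, map_smul, LinearEquiv.apply_symm_apply, smul_eq_mul] at h2
    rw [← h2, LinearMap.sum_apply]
    refine Finset.sum_congr rfl fun i _ => ?_
    simp only [LinearMap.smul_apply, LinearMap.comp_apply, LinearEquiv.coe_coe, h1, smul_eq_mul,
      Basis.coord_apply]
    ring
  have hterm : ∀ i, R.w g * (R.x (b.coord i) * R.y (b i)) =
      ∑ j, R.x (b.coord j ((g : V ≃ₗ[ℂ] V) (b i)) •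
        (b.coord i ∘ₗ (((g⁻¹ : G.W) : V ≃ₗ[ℂ] V) : V →ₗ[ℂ] V))) * R.y (b j) * R.w g := by
    intro i
    rw [← mul_assoc, R.w_x, mul_assoc, R.w_y, hy, ← mul_assoc, Finset.mul_sum, Finset.sum_mul]
    simp [mul_assoc]
  rw [Finset.mul_sum, Finset.sum_congr rfl fun i _ => hterm i, Finset.sum_comm, Finset.sum_mul]
  refine Finset.sum_congr rfl fun j _ => ?_
  rw [← Finset.sum_mul, ← Finset.sum_mul, ← map_sum, hx]

end RCA

/-- **Euler element.** Fix a basis `y₁,…,y_n` of `h` with dual basis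
`x₁,…,x_n` of `h*`, and for a reflection `s` let `λ_s` be the eigenvalue of `s`
on `h*` different from `1`.  Then
`h = Σ_i x_i y_i + n/2 − Σ_{s ∈ S} (2c(s)/(1−λ_s)) s ∈ H_c` satisfies
`[h,x] = x` for `x ∈ h*`, `[h,y] = −y` for `y ∈ h` and `[h,w] = 0` for
`w ∈ W`. -/
theorem euler_element_commutation_relations
    (hc : IsConjInvariant c) (R : RCA G D c)
    {n : ℕ} (b : Basis (Fin n) ℂ V) :
    (∀ a : Module.Dual ℂ V,
        eulerElt R b * R.x a - R.x a * eulerElt R b = R.x a) ∧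
    (∀ v : V,
        eulerElt R b * R.y v - R.y v * eulerElt R b = - R.y v) ∧
    (∀ g : G.W,
        eulerElt R b * R.w g - R.w g * eulerElt R b = 0) := by
  classical
  have := Fintype.ofFinite G.Refl
  have rel : ∀ (v : V) (a : Module.Dual ℂ V),
      R.y v * R.x a - R.x a * R.y v =
        a v • (1 : R.H) - ∑ s : G.Refl, (c s * D.α s v * a (D.αv s)) • R.w s.1 := by
    intro v a
    rw [R.rel, finsum_eq_sum_of_fintype, Algebra.algebraMap_eq_smul_one]
  have hy : ∀ v, ∑ i, b.coord i v • R.y (b i) = R.y v := fun v => by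
    conv_rhs => rw [← b.sum_repr v, map_sum]
    simp
  have hx : ∀ a : Module.Dual ℂ V, ∑ i, a (b i) • R.x (b.coord i) = R.x a := fun a => by
    conv_rhs => rw [← b.sum_dual_apply_smul_coord a, map_sum]
    simp
  have hlam : ∀ s, 1 - D.lam s ≠ 0 := fun s => sub_ne_zero.mpr (D.lam_ne_one s).symm
  unfold eulerElt
  rw [finsum_eq_sum_of_fintype]
  set E := ∑ i, R.x (b.coord i) * R.y (b i) with hE
  set Z := ∑ s : G.Refl, (2 * c s / (1 - D.lam s)) • R.w s.1 with hZ
  have key : ∀ z : R.H, (E + ((n : ℂ) / 2) • (1 : R.H) - Z) * z -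
      z * (E + ((n : ℂ) / 2) • (1 : R.H) - Z) = (E * z - z * E) - (Z * z - z * Z) := by
    intro z
    simp only [sub_mul, mul_sub, add_mul, mul_add, smul_mul_assoc, mul_smul_comm, one_mul, mul_one]
    abel
  have hZz : ∀ z : R.H, Z * z - z * Z =
      ∑ s : G.Refl, (2 * c s / (1 - D.lam s)) • (R.w s.1 * z - z * R.w s.1) := by
    intro z
    rw [hZ, Finset.sum_mul, Finset.mul_sum, ← Finset.sum_sub_distrib]
    simp only [smul_mul_assoc, mul_smul_comm, smul_sub]
  simp only [key]
  refine ⟨fun a => ?_, fun v => ?_, fun g => ?_⟩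
  · have h1 : E * R.x a - R.x a * E =
        R.x a - ∑ s : G.Refl, (c s * a (D.αv s)) • (R.x (D.α s) * R.w s.1) := by
      have hterm : ∀ i, R.x (b.coord i) * R.y (b i) * R.x a -
          R.x a * (R.x (b.coord i) * R.y (b i)) = a (b i) • R.x (b.coord i) -
            ∑ s : G.Refl, (c s * a (D.αv s)) •
              ((D.α s (b i) • R.x (b.coord i)) * R.w s.1) := by
        intro i
        rw [← mul_assoc (R.x a), R.comm_x a, mul_assoc, mul_assoc, ← mul_sub, rel, mul_sub,
          mul_smul_comm, mul_one, Finset.mul_sum]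
        congr 1
        refine Finset.sum_congr rfl fun s _ => ?_
        rw [mul_smul_comm, smul_mul_assoc, smul_smul]
        congr 1
        ring
      rw [hE, Finset.sum_mul, Finset.mul_sum, ← Finset.sum_sub_distrib,
        Finset.sum_congr rfl fun i _ => hterm i, Finset.sum_sub_distrib, hx, Finset.sum_comm]
      congr 1
      refine Finset.sum_congr rfl fun s _ => ?_
      rw [← Finset.smul_sum, ← Finset.sum_mul, hx]
    rw [h1, hZz, sub_sub, ← Finset.sum_add_distrib, Finset.sum_eq_zero, sub_zero]
    intro s _
    rw [R.w_mul_x_sub, smul_smul, ← add_smul]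
    have : c s * a (D.αv s) + 2 * c s / (1 - D.lam s) * ((D.lam s - 1) / 2 * a (D.αv s)) = 0 := by
      have := hlam s
      field_simp
      ring
    rw [this, zero_smul]
  · have h1 : E * R.y v - R.y v * E =
        -R.y v + ∑ s : G.Refl, (c s * D.α s v) • (R.w s.1 * R.y (D.αv s)) := by
      have hterm : ∀ i, R.x (b.coord i) * R.y (b i) * R.y v -
          R.y v * (R.x (b.coord i) * R.y (b i)) = -(b.coord i v • R.y (b i)) +
            ∑ s : G.Refl, (c s * D.α s v) •
              (R.w s.1 * (b.coord i (D.αv s) • R.y (b i))) := by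
        intro i
        rw [mul_assoc, R.comm_y (b i), ← mul_assoc, ← mul_assoc, ← sub_mul, ← neg_sub, rel,
          neg_mul, sub_mul, smul_mul_assoc, one_mul, Finset.sum_mul, neg_sub, sub_eq_neg_add]
        congr 1
        refine Finset.sum_congr rfl fun s _ => ?_
        rw [mul_smul_comm, smul_mul_assoc, smul_smul]
      rw [hE, Finset.sum_mul, Finset.mul_sum, ← Finset.sum_sub_distrib,
        Finset.sum_congr rfl fun i _ => hterm i, Finset.sum_add_distrib, Finset.sum_neg_distrib,
        hy, Finset.sum_comm]
      congr 1
      refine Finset.sum_congr rfl fun s _ => ?_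
      rw [← Finset.smul_sum, ← Finset.mul_sum, hy]
    rw [h1, hZz, add_sub_assoc, ← Finset.sum_sub_distrib, Finset.sum_eq_zero, add_zero]
    intro s _
    rw [R.w_mul_y_sub, smul_smul, ← sub_smul]
    have : c s * D.α s v - 2 * c s / (1 - D.lam s) * ((1 - D.lam s) / 2 * D.α s v) = 0 := by
      have := hlam s
      field_simp
      ring
    rw [this, zero_smul]
  · have h1 : Z * R.w g = R.w g * Z := by
      rw [hZ, Finset.sum_mul, Finset.mul_sum, ← Equiv.sum_comp (G.conjRefl g)]
      refine Finset.sum_congr rfl fun s _ => ?_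
      rw [D.lam_conj g (G.coe_conjRefl g s), hc s _ ⟨g, G.coe_conjRefl g s⟩, G.coe_conjRefl,
        smul_mul_assoc, mul_smul_comm, ← map_mul, ← map_mul, inv_mul_cancel_right]
    rw [h1, R.sum_x_mul_y_mul_w, sub_self, sub_self, sub_zero]

end
end Euler
end

section
/- The category O_c(W) has enough projective objects, and every object of O_c(W) has finite length. -/
namespace RCA

section Algebra

open Polynomial

variable {V : Type} [AddCommGroup V] [Module ℂ V] [FiniteDimensional ℂ V]
variable {G : CRG V} {D : ReflData G} {c : G.Refl → ℂ}

instance (G : CRG V) : Finite G.W := G.finite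

instance (G : CRG V) : Finite G.Refl :=
  inferInstanceAs (Finite {s : G.W // IsComplexReflection (s : V ≃ₗ[ℂ] V)})

noncomputable instance (G : CRG V) : Fintype G.Refl := Fintype.ofFinite _

theorem adjoin_eq_top (R : RCA G D c) :
    Algebra.adjoin ℂ (Set.range R.x ∪ Set.range R.y ∪ Set.range R.w) = ⊤ := by
  set A := Algebra.adjoin ℂ (Set.range R.x ∪ Set.range R.y ∪ Set.range R.w) with hA
  have hx : ∀ a, R.x a ∈ A := fun a =>
    Algebra.subset_adjoin (Or.inl (Or.inl ⟨a, rfl⟩))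
  have hy : ∀ a, R.y a ∈ A := fun a =>
    Algebra.subset_adjoin (Or.inl (Or.inr ⟨a, rfl⟩))
  have hw : ∀ a, R.w a ∈ A := fun a => Algebra.subset_adjoin (Or.inr ⟨a, rfl⟩)
  let xA : Module.Dual ℂ V →ₗ[ℂ] A := R.x.codRestrict (Subalgebra.toSubmodule A) hx
  let yA : V →ₗ[ℂ] A := R.y.codRestrict (Subalgebra.toSubmodule A) hy
  let wA : G.W →* A := R.w.codRestrict A hw
  obtain ⟨φ, ⟨h1, h2, h3⟩, -⟩ := R.universal A xA yA wA
    (fun a b => Subtype.ext (R.comm_x a b)) (fun a b => Subtype.ext (R.comm_y a b))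
    (fun a b => Subtype.ext (R.w_x a b)) (fun a b => Subtype.ext (R.w_y a b))
    (fun v a => by
      apply Subtype.ext
      have := R.rel v a
      rw [finsum_eq_sum_of_fintype] at this ⊢
      refine this.trans ?_
      simp [wA])
  obtain ⟨ψ, -, hψ⟩ := R.universal R.H R.x R.y R.w R.comm_x R.comm_y R.w_x R.w_y R.rel
  have e : A.val.comp φ = AlgHom.id ℂ R.H := by
    rw [hψ (A.val.comp φ) ⟨fun a => congrArg Subtype.val (h1 a),
      fun a => congrArg Subtype.val (h2 a), fun a => congrArg Subtype.val (h3 a)⟩,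
      hψ (AlgHom.id ℂ R.H) ⟨fun _ => rfl, fun _ => rfl, fun _ => rfl⟩]
  refine (Algebra.eq_top_iff).2 fun h => ?_
  have : ((φ h : A) : R.H) = h := DFunLike.congr_fun e h
  exact this ▸ (φ h).2

/-- An induction principle for showing that a complex subspace is an `H_c`-submodule. -/
theorem smul_mem_of_stable (R : RCA G D c) {M : Type} [AddCommGroup M] [Module R.H M]
    [Module ℂ M] [IsScalarTower ℂ R.H M] (S : Submodule ℂ M)
    (hx : ∀ a, ∀ m ∈ S, R.x a • m ∈ S) (hy : ∀ v, ∀ m ∈ S, R.y v • m ∈ S)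
    (hw : ∀ g, ∀ m ∈ S, R.w g • m ∈ S) (h : R.H) : ∀ m ∈ S, h • m ∈ S := by
  have hh : h ∈ Algebra.adjoin ℂ (Set.range R.x ∪ Set.range R.y ∪ Set.range R.w) := by
    rw [R.adjoin_eq_top]; trivial
  induction hh using Algebra.adjoin_induction with
  | mem h hm =>
    rcases hm with (⟨a, rfl⟩ | ⟨a, rfl⟩) | ⟨a, rfl⟩
    · exact hx a
    · exact hy a
    · exact hw a
  | algebraMap r =>
    intro m hm
    rw [algebraMap_smul]
    exact S.smul_mem r hm
  | add a b _ _ ha hb =>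
    intro m hm
    rw [add_smul]
    exact S.add_mem (ha m hm) (hb m hm)
  | mul a b _ _ ha hb =>
    intro m hm
    rw [mul_smul]
    exact ha _ (hb m hm)

theorem refl_symm_apply (D : ReflData G) (s : G.Refl) (v : V) :
    (s.1 : V ≃ₗ[ℂ] V).symm v = v + ((D.lam s - 1) / 2 * D.α s v) • D.αv s := by
  obtain ⟨μ, hμ, hs⟩ := D.eig_αv s
  set g : V ≃ₗ[ℂ] V := (s.1 : V ≃ₗ[ℂ] V)
  have hr : Module.finrank ℂ (LinearMap.range (g.toLinearMap - LinearMap.id)) = 1 := s.2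
  have hmem : D.αv s ∈ LinearMap.range (g.toLinearMap - LinearMap.id) := by
    refine ⟨(μ - 1)⁻¹ • D.αv s, ?_⟩
    have h1 : μ - 1 ≠ 0 := sub_ne_zero.2 hμ
    simp only [map_smul, LinearMap.sub_apply, LinearEquiv.coe_coe, LinearMap.id_apply, hs]
    nth_rewrite 2 [← one_smul ℂ (D.αv s)]
    rw [← sub_smul, smul_smul, inv_mul_cancel₀ h1, one_smul]
  obtain ⟨k, hk⟩ := (finrank_eq_one_iff_of_nonzero'
    (⟨D.αv s, hmem⟩ : LinearMap.range (g.toLinearMap - LinearMap.id))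
    (fun h => D.αv_ne s (congrArg Subtype.val h))).1 hr
    ⟨(g.toLinearMap - LinearMap.id : V →ₗ[ℂ] V) (g.symm v), ⟨_, rfl⟩⟩
  have hk' : k • D.αv s = v - g.symm v := by
    simpa using congrArg Subtype.val hk
  have h2 := congrArg (D.α s) hk'
  simp only [map_smul, map_sub, D.pairing, smul_eq_mul] at h2
  rw [show D.α s (g.symm v) = D.lam s * D.α s v from D.eig_α s v] at h2
  have h3 : (D.lam s - 1) / 2 * D.α s v = -k := by linear_combination (1/2) * h2
  rw [h3, neg_smul, hk']
  abel

theorem dual_comp_refl_inv (D : ReflData G) (s : G.Refl) (a : Module.Dual ℂ V) :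
    a ∘ₗ (((s.1⁻¹ : G.W) : V ≃ₗ[ℂ] V) : V →ₗ[ℂ] V) =
      a + ((D.lam s - 1) / 2 * a (D.αv s)) • D.α s := by
  ext v
  have : a ((s.1 : V ≃ₗ[ℂ] V).symm v) = _ := congrArg a (refl_symm_apply D s v)
  simp only [map_add, map_smul, smul_eq_mul] at this
  change a ((s.1 : V ≃ₗ[ℂ] V).symm v) = _
  rw [this]
  simp
  ring

theorem lam_conj (D : ReflData G) (s t : G.Refl) (g : G.W) (h : t.1 = g * s.1 * g⁻¹) :
    D.lam t = D.lam s := by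
  have e : ((t.1 : G.W) : V ≃ₗ[ℂ] V).symm ((g : V ≃ₗ[ℂ] V) (D.αv s)) =
      (g : V ≃ₗ[ℂ] V) ((s.1 : V ≃ₗ[ℂ] V).symm (D.αv s)) := by
    rw [LinearEquiv.symm_apply_eq, h]
    have : ((g * s.1 * g⁻¹ : G.W) : V ≃ₗ[ℂ] V) ((g : V ≃ₗ[ℂ] V)
        ((s.1 : V ≃ₗ[ℂ] V).symm (D.αv s))) = (g : V ≃ₗ[ℂ] V) ((s.1 : V ≃ₗ[ℂ] V)
        ((g : V ≃ₗ[ℂ] V).symm ((g : V ≃ₗ[ℂ] V) ((s.1 : V ≃ₗ[ℂ] V).symm (D.αv s))))) := rfl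
    rw [this]
    simp
  rw [refl_symm_apply D t, refl_symm_apply D s, map_add, add_right_inj, map_smul,
    D.pairing] at e
  have h1 := congrArg (D.α t) e
  simp only [map_smul, D.pairing, smul_eq_mul] at h1
  by_cases h0 : D.α t ((g : V ≃ₗ[ℂ] V) (D.αv s)) = 0
  · rw [h0, mul_zero, zero_smul] at e
    have h2 : D.lam s - 1 ≠ 0 := sub_ne_zero.2 (D.lam_ne_one s)
    have := (smul_eq_zero.1 e.symm).resolve_left (by simpa using h2)
    exact absurd ((LinearEquiv.map_eq_zero_iff _).1 this) (D.αv_ne s)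
  · have : (D.lam t - D.lam s) * D.α t ((g : V ≃ₗ[ℂ] V) (D.αv s)) = 0 := by
      linear_combination h1
    exact sub_eq_zero.1 ((mul_eq_zero.1 this).resolve_right h0)

theorem isComplexReflection_conj {V : Type} [AddCommGroup V] [Module ℂ V] (s g : V ≃ₗ[ℂ] V) (hs : IsComplexReflection s) :
    IsComplexReflection (g * s * g⁻¹) := by
  unfold IsComplexReflection at *
  have : (g * s * g⁻¹).toLinearMap - LinearMap.id =
      g.toLinearMap ∘ₗ (s.toLinearMap - LinearMap.id) ∘ₗ g.symm.toLinearMap := by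
    ext v
    change g (s (g.symm v)) - v = g (s (g.symm v) - g.symm v)
    simp
  rw [this, LinearMap.range_comp, LinearMap.range_comp_of_range_eq_top _ g.symm.range,
    LinearEquiv.finrank_map_eq, hs]

/-- Conjugation of a reflection by an element of the group. -/
def conjRefl (g : G.W) (s : G.Refl) : G.Refl :=
  ⟨g * s.1 * g⁻¹, isComplexReflection_conj _ _ s.2⟩

/-- The part of the Euler element supported on the group algebra. -/
noncomputable def euW (R : RCA G D c) : R.H :=
  ∑ s : G.Refl, (2 * c s / (D.lam s - 1)) • R.w s.1

/-- The part of the Euler element coming from the canonical element of `h* ⊗ h`. -/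
noncomputable def euXY (R : RCA G D c) : R.H :=
  ∑ i, R.x ((Module.finBasis ℂ V).coord i) * R.y (Module.finBasis ℂ V i)

/-- The Euler element. -/
noncomputable def eu (R : RCA G D c) : R.H := R.euXY + R.euW

theorem rel' (R : RCA G D c) (v : V) (a : Module.Dual ℂ V) :
    R.y v * R.x a = R.x a * R.y v + (a v • (1 : R.H) -
        ∑ s : G.Refl, (c s * D.α s v * a (D.αv s)) • R.w s.1) := by
  rw [← Algebra.algebraMap_eq_smul_one, ← finsum_eq_sum_of_fintype, ← R.rel]
  abel

theorem euW_mul_x (R : RCA G D c) (a : Module.Dual ℂ V) :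
    R.euW * R.x a = R.x a * R.euW +
      ∑ s : G.Refl, (c s * a (D.αv s)) • (R.x (D.α s) * R.w s.1) := by
  rw [euW, Finset.sum_mul, Finset.mul_sum, ← Finset.sum_add_distrib]
  refine Finset.sum_congr rfl fun s _ => ?_
  have h2 : D.lam s - 1 ≠ 0 := sub_ne_zero.2 (D.lam_ne_one s)
  rw [smul_mul_assoc, R.w_x, dual_comp_refl_inv D, map_add, map_smul, add_mul, smul_add,
    mul_smul_comm, smul_mul_assoc, smul_smul]
  congr 2
  field_simp

theorem euW_mul_y (R : RCA G D c) (v : V) :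
    R.euW * R.y v = R.y v * R.euW -
      ∑ s : G.Refl, (c s * D.α s v) • (R.w s.1 * R.y (D.αv s)) := by
  rw [euW, Finset.sum_mul, Finset.mul_sum, ← Finset.sum_sub_distrib]
  refine Finset.sum_congr rfl fun s _ => ?_
  have h2 : D.lam s - 1 ≠ 0 := sub_ne_zero.2 (D.lam_ne_one s)
  have h := R.w_y s.1 ((s.1 : V ≃ₗ[ℂ] V).symm v)
  rw [LinearEquiv.apply_symm_apply, refl_symm_apply D, map_add, map_smul, mul_add,
    mul_smul_comm] at h
  rw [mul_smul_comm, ← h, smul_mul_assoc, smul_add, smul_smul]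
  have : 2 * c s / (D.lam s - 1) * ((D.lam s - 1) / 2 * D.α s v) = c s * D.α s v := by
    field_simp
  rw [this]
  abel

theorem sum_coord_smul (a : Module.Dual ℂ V) :
    ∑ i, a (Module.finBasis ℂ V i) • (Module.finBasis ℂ V).coord i = a := by
  refine (Module.finBasis ℂ V).ext fun j => ?_
  simp

theorem sum_coord_apply_smul (v : V) :
    ∑ i, (Module.finBasis ℂ V).coord i v • (Module.finBasis ℂ V i) = v :=
  (Module.finBasis ℂ V).sum_repr v

theorem eu_mul_x (R : RCA G D c) (a : Module.Dual ℂ V) :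
    R.eu * R.x a = R.x a * (R.eu + 1) := by
  have h : R.euXY * R.x a = R.x a * R.euXY + R.x a -
      ∑ s : G.Refl, (c s * a (D.αv s)) • (R.x (D.α s) * R.w s.1) := by
    have h1 : R.x a = ∑ i, a (Module.finBasis ℂ V i) • R.x ((Module.finBasis ℂ V).coord i) := by
      conv_lhs => rw [← sum_coord_smul a]
      simp only [map_sum, map_smul]
    have h2 : ∑ s : G.Refl, (c s * a (D.αv s)) • (R.x (D.α s) * R.w s.1) =
        ∑ i, R.x ((Module.finBasis ℂ V).coord i) * ∑ s : G.Refl,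
          (c s * D.α s (Module.finBasis ℂ V i) * a (D.αv s)) • R.w s.1 := by
      simp_rw [Finset.mul_sum]
      rw [Finset.sum_comm]
      refine Finset.sum_congr rfl fun s _ => ?_
      conv_lhs => rw [← sum_coord_smul (D.α s)]
      rw [map_sum, Finset.sum_mul, Finset.smul_sum]
      refine Finset.sum_congr rfl fun i _ => ?_
      rw [map_smul, smul_mul_assoc, smul_smul, mul_smul_comm]
      congr 1
      ring
    rw [h2, add_sub_assoc]
    conv_rhs => enter [2, 1]; rw [h1]
    rw [← Finset.sum_sub_distrib, euXY, Finset.sum_mul, Finset.mul_sum,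
      ← Finset.sum_add_distrib]
    refine Finset.sum_congr rfl fun i _ => ?_
    rw [mul_assoc, R.rel', mul_add, ← mul_assoc, R.comm_x, mul_assoc, mul_sub, mul_smul_comm,
      mul_one]
  rw [eu, add_mul, h, euW_mul_x, mul_add, mul_add, mul_one]
  abel

theorem eu_mul_y (R : RCA G D c) (v : V) :
    R.eu * R.y v = R.y v * (R.eu - 1) := by
  have h : R.y v * R.euXY = R.euXY * R.y v + R.y v -
      ∑ s : G.Refl, (c s * D.α s v) • (R.w s.1 * R.y (D.αv s)) := by
    have h1 : R.y v = ∑ i, (Module.finBasis ℂ V).coord i v • R.y (Module.finBasis ℂ V i) := by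
      conv_lhs => rw [← sum_coord_apply_smul v]
      simp only [map_sum, map_smul]
    have h2 : ∑ s : G.Refl, (c s * D.α s v) • (R.w s.1 * R.y (D.αv s)) =
        ∑ i, (∑ s : G.Refl, (c s * D.α s v * (Module.finBasis ℂ V).coord i (D.αv s)) •
          R.w s.1) * R.y (Module.finBasis ℂ V i) := by
      simp_rw [Finset.sum_mul]
      rw [Finset.sum_comm]
      refine Finset.sum_congr rfl fun s _ => ?_
      conv_lhs => rw [← sum_coord_apply_smul (D.αv s)]
      rw [map_sum, Finset.mul_sum, Finset.smul_sum]
      refine Finset.sum_congr rfl fun i _ => ?_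
      rw [map_smul, mul_smul_comm, smul_smul, smul_mul_assoc]
    rw [h2, add_sub_assoc]
    conv_rhs => enter [2, 1]; rw [h1]
    rw [← Finset.sum_sub_distrib, euXY, Finset.sum_mul, Finset.mul_sum,
      ← Finset.sum_add_distrib]
    refine Finset.sum_congr rfl fun i _ => ?_
    rw [← mul_assoc, R.rel', add_mul, mul_assoc, R.comm_y, mul_assoc, sub_mul, smul_mul_assoc,
      one_mul]
  rw [eu, add_mul, euW_mul_y, mul_sub, mul_add, h, mul_one]
  abel

theorem w_mul_euW (hc : IsConjInvariant c) (R : RCA G D c) (g : G.W) :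
    R.w g * R.euW = R.euW * R.w g := by
  rw [euW, Finset.sum_mul, Finset.mul_sum]
  refine Finset.sum_nbij' (conjRefl g) (conjRefl g⁻¹) (by simp) (by simp)
    (fun s _ => Subtype.ext (by simp [conjRefl, mul_assoc]))
    (fun s _ => Subtype.ext (by simp [conjRefl, mul_assoc])) fun s _ => ?_
  rw [hc s (conjRefl g s) ⟨g, rfl⟩, lam_conj D s (conjRefl g s) g rfl, mul_smul_comm,
    smul_mul_assoc, ← map_mul, ← map_mul]
  simp [conjRefl]

theorem w_mul_euXY (R : RCA G D c) (g : G.W) : R.w g * R.euXY = R.euXY * R.w g := by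
  set b := Module.finBasis ℂ V with hb
  let g' : V ≃ₗ[ℂ] V := g
  have h1 : R.w g * R.euXY = (∑ i, R.x (b.coord i ∘ₗ g'.symm.toLinearMap) * R.y (g' (b i))) *
      R.w g := by
    rw [euXY, Finset.sum_mul, Finset.mul_sum]
    refine Finset.sum_congr rfl fun i _ => ?_
    rw [← mul_assoc, R.w_x, mul_assoc, R.w_y, ← mul_assoc]
    rfl
  rw [h1]
  congr 1
  have h2 : ∀ i, R.x (b.coord i ∘ₗ g'.symm.toLinearMap) =
      ∑ j, b.coord i (g'.symm (b j)) • R.x (b.coord j) := by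
    intro i
    conv_lhs => rw [← sum_coord_smul (b.coord i ∘ₗ g'.symm.toLinearMap)]
    simp [hb]
  simp_rw [h2, Finset.sum_mul]
  rw [Finset.sum_comm, euXY]
  refine Finset.sum_congr rfl fun j _ => ?_
  simp_rw [smul_mul_assoc, ← mul_smul_comm, ← Finset.mul_sum]
  congr 1
  have h3 : b j = ∑ i, b.coord i (g'.symm (b j)) • g' (b i) := by
    have := congrArg g' (sum_coord_apply_smul (g'.symm (b j)))
    rw [LinearEquiv.apply_symm_apply, map_sum] at this
    simp only [map_smul] at this
    exact this.symm
  rw [← hb]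
  conv_rhs => rw [h3]
  simp only [map_sum, map_smul]

theorem eu_mul_w (hc : IsConjInvariant c) (R : RCA G D c) (g : G.W) :
    R.eu * R.w g = R.w g * R.eu := by
  rw [eu, add_mul, mul_add, R.w_mul_euXY, w_mul_euW hc]

theorem isIntegral_euW (R : RCA G D c) : IsIntegral ℂ R.euW := by
  let φ : MonoidAlgebra ℂ G.W →ₐ[ℂ] R.H := MonoidAlgebra.lift ℂ R.H G.W R.w
  have : φ (∑ s : G.Refl, (2 * c s / (D.lam s - 1)) • MonoidAlgebra.of ℂ G.W s.1) = R.euW := by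
    rw [map_sum, euW]
    refine Finset.sum_congr rfl fun s _ => ?_
    rw [map_smul]
    simp [φ]
  rw [← this]
  exact (IsIntegral.of_finite ℂ _).map φ

/-- The minimal polynomial of the group part of the Euler element. -/
noncomputable def lowPoly (R : RCA G D c) : ℂ[X] := minpoly ℂ R.euW

theorem lowPoly_ne_zero (R : RCA G D c) : R.lowPoly ≠ 0 := minpoly.ne_zero R.isIntegral_euW

theorem aeval_mul_of_shift {A : Type*} [Ring A] [Algebra ℂ A] {e u : A} {r : ℂ}
    (h : e * u = u * (e + algebraMap ℂ A r)) (p : ℂ[X]) :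
    aeval e p * u = u * aeval e (p.comp (X + C r)) := by
  induction p using Polynomial.induction_on' with
  | add p q hp hq => simp [add_mul, mul_add, hp, hq]
  | monomial n a =>
    have : e ^ n * u = u * (e + algebraMap ℂ A r) ^ n :=
      ((show SemiconjBy u (e + algebraMap ℂ A r) e from h.symm).pow_right n).symm
    simp only [aeval_monomial, monomial_comp, map_mul, map_pow, map_add, aeval_X, aeval_C]
    rw [mul_assoc, this, ← mul_assoc, Algebra.commutes, mul_assoc]

theorem aeval_mul_x (R : RCA G D c) (a : Module.Dual ℂ V) (p : ℂ[X]) :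
    aeval R.eu p * R.x a = R.x a * aeval R.eu (p.comp (X + C 1)) :=
  aeval_mul_of_shift (by rw [map_one, eu_mul_x]) p

theorem aeval_mul_y (R : RCA G D c) (v : V) (p : ℂ[X]) :
    aeval R.eu p * R.y v = R.y v * aeval R.eu (p.comp (X + C (-1))) :=
  aeval_mul_of_shift (by rw [map_neg, map_one, eu_mul_y, sub_eq_add_neg]) p

theorem aeval_mul_w (hc : IsConjInvariant c) (R : RCA G D c) (g : G.W) (p : ℂ[X]) :
    aeval R.eu p * R.w g = R.w g * aeval R.eu p := by
  have := aeval_mul_of_shift (e := R.eu) (u := R.w g) (r := 0) (by rw [map_zero, add_zero, eu_mul_w hc R g]) p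
  simpa using this

end Algebra

end RCA

namespace RCA

section PolynomialLemmas

open Polynomial

theorem exists_isCoprime_shift {f g : ℂ[X]} (hf : f ≠ 0) (hg : g ≠ 0) {ε : ℂ} (hε : ε ≠ 0) :
    ∃ n : ℕ, ∀ j : ℕ, n ≤ j → IsCoprime (f.comp (X + C (ε * j))) g := by
  classical
  have hfin : {j : ℕ | ∃ p ∈ (f.rootSet ℂ ×ˢ g.rootSet ℂ), p.1 = p.2 + ε * j}.Finite := by
    have h1 : ((f.rootSet ℂ ×ˢ g.rootSet ℂ)).Finite :=
      (f.rootSet_finite ℂ).prod (g.rootSet_finite ℂ)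
    refine (h1.image fun p => (p.1 - p.2) / ε).preimage
      (f := fun j : ℕ => (j : ℂ)) Nat.cast_injective.injOn |>.subset ?_
    rintro j ⟨p, hp, h⟩
    exact ⟨p, hp, by simp [h, mul_div_cancel_left₀ _ hε]⟩
  obtain ⟨n, hn⟩ := hfin.bddAbove
  refine ⟨n + 1, fun j hj => ?_⟩
  rw [isCoprime_iff_aeval_ne_zero_of_isAlgClosed ℂ ℂ]
  intro a
  by_contra! h
  have : j ≤ n := hn ⟨(a + ε * j, a), ⟨(mem_rootSet.2 ⟨hf, by simpa [aeval_comp] using h.1⟩),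
    (mem_rootSet.2 ⟨hg, h.2⟩)⟩, rfl⟩
  omega

/-- Every nonzero polynomial splits into a factor supported at `f` and a factor coprime
to `f`. -/
theorem exists_mul_dvd_pow_isCoprime (f : ℂ[X]) {Q : ℂ[X]} (hQ : Q ≠ 0) :
    ∃ k A B, Q = A * B ∧ A ∣ f ^ k ∧ IsCoprime B f := by
  induction Q using UniqueFactorizationMonoid.induction_on_prime with
  | h₁ => exact absurd rfl hQ
  | h₂ x hx => exact ⟨0, x, 1, by simp, hx.dvd, isCoprime_one_left⟩
  | h₃ a p ha hp ih =>
    obtain ⟨k, A, B, rfl, hA, hB⟩ := ih ha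
    by_cases h : p ∣ f
    · exact ⟨k + 1, p * A, B, by ring, by rw [pow_succ']; exact mul_dvd_mul h hA, hB⟩
    · exact ⟨k, A, p * B, by ring, hA,
        IsCoprime.mul_left ((hp.irreducible.coprime_iff_not_dvd).2 h) hB⟩

variable {H M : Type*} [Ring H] [Algebra ℂ H] [AddCommGroup M] [Module H M]

theorem eq_zero_of_isCoprime {e : H} {p q : ℂ[X]} (h : IsCoprime p q) {m : M}
    (hp : aeval e p • m = 0) (hq : aeval e q • m = 0) : m = 0 := by
  obtain ⟨a, b, hab⟩ := h
  rw [← one_smul H m, ← map_one (aeval (R := ℂ) e), ← hab, map_add, map_mul, map_mul, add_smul,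
    mul_smul, mul_smul, hp, hq, smul_zero, smul_zero, add_zero]

theorem aeval_smul_eq_zero_of_dvd {e : H} {p q : ℂ[X]} (h : p ∣ q) {m : M}
    (hp : aeval e p • m = 0) : aeval e q • m = 0 := by
  obtain ⟨r, rfl⟩ := h
  rw [mul_comm, map_mul, mul_smul, hp, smul_zero]

theorem aeval_smul_comm (e : H) (p q : ℂ[X]) (m : M) :
    aeval e p • aeval e q • m = aeval e q • aeval e p • m := by
  rw [← mul_smul, ← mul_smul, ← map_mul, ← map_mul, mul_comm]

theorem mem_of_isCoprime {e : H} {p q : ℂ[X]} (h : IsCoprime p q) {N : Submodule H M} {m : M}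
    (hp : aeval e p • m ∈ N) (hq : aeval e q • m ∈ N) : m ∈ N := by
  rw [← Submodule.Quotient.mk_eq_zero] at hp hq ⊢
  exact eq_zero_of_isCoprime h (by simpa using hp) (by simpa using hq)

end PolynomialLemmas

section Modules

open Polynomial

variable {V : Type} [AddCommGroup V] [Module ℂ V] [FiniteDimensional ℂ V]
variable {G : CRG V} {D : ReflData G} {c : G.Refl → ℂ}

section

variable (R : RCA G D c) (M : Type) [AddCommGroup M] [Module R.H M]
  [Module ℂ M] [IsScalarTower ℂ R.H M]

/-- The subspace of vectors killed by all products of `n` elements of `h`. -/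
def nilp : ℕ → Submodule ℂ M
  | 0 => ⊥
  | n + 1 =>
    { carrier := {m | ∀ v, R.y v • m ∈ nilp n}
      zero_mem' := fun v => by rw [smul_zero]; exact zero_mem _
      add_mem' := fun ha hb v => by rw [smul_add]; exact add_mem (ha v) (hb v)
      smul_mem' := fun r m hm v => by
        rw [smul_algebra_smul_comm]; exact Submodule.smul_mem _ r (hm v) }

/-- The generalized eigenspace of the Euler element at the roots of `f`. -/
noncomputable def genEig (f : ℂ[X]) : Submodule ℂ M where
  carrier := {m | ∃ k, aeval R.eu (f ^ k) • m = 0}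
  zero_mem' := ⟨0, smul_zero _⟩
  add_mem' := by
    rintro a b ⟨k, hk⟩ ⟨l, hl⟩
    refine ⟨k + l, ?_⟩
    rw [smul_add, aeval_smul_eq_zero_of_dvd (pow_dvd_pow f (Nat.le_add_right k l)) hk,
      aeval_smul_eq_zero_of_dvd (pow_dvd_pow f (Nat.le_add_left l k)) hl, add_zero]
  smul_mem' := by
    rintro r m ⟨k, hk⟩
    exact ⟨k, by rw [smul_algebra_smul_comm, hk, smul_zero]⟩

/-- The action of `H_c` on a module, as a complex bilinear map. -/
def act : R.H →ₗ[ℂ] M →ₗ[ℂ] M := (Algebra.lsmul ℂ ℂ M).toLinearMap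

/-- The product of the `n`-th power of `h*` with a subspace. -/
def xPow (U : Submodule ℂ M) : ℕ → Submodule ℂ M
  | 0 => U
  | n + 1 => Submodule.map₂ (R.act M) (LinearMap.range R.x) (xPow U n)

end

section

variable {R : RCA G D c} {M : Type} [AddCommGroup M] [Module R.H M]
  [Module ℂ M] [IsScalarTower ℂ R.H M]

theorem mem_nilp_succ {n : ℕ} {m : M} :
    m ∈ R.nilp M (n + 1) ↔ ∀ v, R.y v • m ∈ R.nilp M n := Iff.rfl

theorem mem_nilp_iff {n : ℕ} {m : M} : m ∈ R.nilp M n ↔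
    ∀ L : List V, L.length = n → (L.map fun v => R.y v).prod • m = 0 := by
  induction n generalizing m with
  | zero =>
    simp only [List.length_eq_zero_iff, forall_eq, List.map_nil, List.prod_nil, one_smul]
    exact Submodule.mem_bot ℂ
  | succ n ih =>
    rw [mem_nilp_succ]
    simp_rw [ih]
    constructor
    · intro h L hL
      obtain ⟨L, v, rfl⟩ : ∃ L' v, L = L' ++ [v] :=
        ⟨L.dropLast, L.getLast (by rintro rfl; simp at hL),
          (List.dropLast_append_getLast _).symm⟩
      simpa [mul_smul] using h v L (by simpa using hL)
    · intro h v L hL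
      simpa [mul_smul] using h (L ++ [v]) (by simpa using hL)

theorem nilp_le_succ (n : ℕ) : R.nilp M n ≤ R.nilp M (n + 1) := by
  induction n with
  | zero => exact bot_le
  | succ n ih => exact fun m hm v => ih (hm v)

theorem nilp_mono : Monotone (R.nilp M) := monotone_nat_of_le_succ nilp_le_succ

theorem w_smul_mem_nilp (g : G.W) {n : ℕ} {m : M} (hm : m ∈ R.nilp M n) :
    R.w g • m ∈ R.nilp M n := by
  induction n generalizing m with
  | zero => rw [(Submodule.mem_bot ℂ).1 hm, smul_zero]; exact zero_mem _
  | succ n ih =>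
    intro v
    have h := R.w_y g ((g : V ≃ₗ[ℂ] V).symm v)
    rw [LinearEquiv.apply_symm_apply] at h
    rw [← mul_smul, ← h, mul_smul]
    exact ih (hm _)

theorem x_smul_mem_nilp (a : Module.Dual ℂ V) {n : ℕ} {m : M} (hm : m ∈ R.nilp M n) :
    R.x a • m ∈ R.nilp M (n + 1) := by
  induction n generalizing m with
  | zero => rw [(Submodule.mem_bot ℂ).1 hm, smul_zero]; exact zero_mem _
  | succ n ih =>
    intro v
    rw [← mul_smul, R.rel', add_smul, sub_smul, mul_smul, smul_assoc, one_smul, Finset.sum_smul]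
    refine add_mem (ih (hm v)) (sub_mem (Submodule.smul_mem _ _ hm) (sum_mem fun s _ => ?_))
    rw [smul_assoc]
    exact Submodule.smul_mem _ _ (w_smul_mem_nilp _ hm)

theorem smul_mem_iSup_nilp (h : R.H) {m : M} (hm : ∃ n, m ∈ R.nilp M n) :
    ∃ n, h • m ∈ R.nilp M n := by
  simp_rw [← Submodule.mem_iSup_of_directed _ (nilp_mono (R := R) (M := M)).directed_le] at hm ⊢
  have key : ∀ m : M, (∃ n, m ∈ R.nilp M n) ↔ m ∈ ⨆ n, R.nilp M n := fun m =>
    (Submodule.mem_iSup_of_directed _ (nilp_mono (R := R) (M := M)).directed_le).symm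
  refine R.smul_mem_of_stable _ ?_ ?_ ?_ h m hm
  · intro a m hm
    obtain ⟨n, hn⟩ := (key m).2 hm
    exact (key _).1 ⟨_, x_smul_mem_nilp a hn⟩
  · intro v m hm
    obtain ⟨n, hn⟩ := (key m).2 hm
    exact (key _).1 ⟨n, nilp_le_succ n hn v⟩
  · intro v m hm
    obtain ⟨n, hn⟩ := (key m).2 hm
    exact (key _).1 ⟨n, w_smul_mem_nilp v hn⟩

theorem y_smul_euW_smul_mem {F : Submodule R.H M} {m : M} (hm : ∀ v, R.y v • m ∈ F) (v : V) :
    R.y v • R.euW • m ∈ F := by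
  rw [euW, Finset.sum_smul, Finset.smul_sum]
  refine sum_mem fun s _ => ?_
  have h := R.w_y s.1 ((s.1 : V ≃ₗ[ℂ] V).symm v)
  rw [LinearEquiv.apply_symm_apply] at h
  rw [smul_assoc, smul_algebra_smul_comm, ← mul_smul, ← h, mul_smul]
  exact F.smul_of_tower_mem _ (F.smul_mem _ (hm _))

theorem aeval_smul_sub_mem {F : Submodule R.H M} (p : ℂ[X]) {m : M}
    (hm : ∀ v, R.y v • m ∈ F) : aeval R.eu p • m - aeval R.euW p • m ∈ F := by
  induction p using Polynomial.induction_on generalizing m with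
  | C a => simp
  | add p q hp hq =>
    have := add_mem (hp hm) (hq hm)
    simp only [map_add, add_smul]
    convert this using 1
    abel
  | monomial n a ih =>
    have h1 := ih (y_smul_euW_smul_mem hm)
    have h2 : R.eu • m - R.euW • m ∈ F := by
      rw [← sub_smul, eu, add_sub_cancel_right, euXY, Finset.sum_smul]
      exact sum_mem fun i _ => by rw [mul_smul]; exact F.smul_mem _ (hm _)
    have h3 := add_mem (F.smul_mem (aeval R.eu (C a * X ^ n)) h2) h1
    rw [smul_sub] at h3
    simp only [pow_succ, ← mul_assoc]
    rw [map_mul _ _ X, map_mul _ _ X, aeval_X, aeval_X, mul_smul, mul_smul]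
    convert h3 using 1
    abel

theorem lowPoly_smul_mem {F : Submodule R.H M} {m : M} (hm : ∀ v, R.y v • m ∈ F) :
    aeval R.eu R.lowPoly • m ∈ F := by
  have := aeval_smul_sub_mem R.lowPoly hm
  rwa [lowPoly, minpoly.aeval, zero_smul, sub_zero] at this

/-- The submodule of vectors on which the Euler element acts locally finitely. -/
noncomputable def eulerFinite (hc : IsConjInvariant c) (R : RCA G D c) (M : Type)
    [AddCommGroup M] [Module R.H M] [Module ℂ M] [IsScalarTower ℂ R.H M] : Submodule R.H M :=
  let S : Submodule ℂ M :=
    { carrier := {m | ∃ Q : ℂ[X], Q ≠ 0 ∧ aeval R.eu Q • m = 0}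
      zero_mem' := ⟨1, one_ne_zero, smul_zero _⟩
      add_mem' := by
        rintro a b ⟨p, hp, ha⟩ ⟨q, hq, hb⟩
        refine ⟨p * q, mul_ne_zero hp hq, ?_⟩
        rw [smul_add, aeval_smul_eq_zero_of_dvd (dvd_mul_right p q) ha,
          aeval_smul_eq_zero_of_dvd (dvd_mul_left q p) hb, add_zero]
      smul_mem' := by
        rintro r m ⟨p, hp, ha⟩
        exact ⟨p, hp, by rw [smul_algebra_smul_comm, ha, smul_zero]⟩ }
  { S with
    smul_mem' := fun h m hm => by
      refine R.smul_mem_of_stable S ?_ ?_ ?_ h m hm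
      · rintro a m ⟨p, hp, hm⟩
        refine ⟨p.comp (X + C (-1)), by rwa [Ne, comp_X_add_C_eq_zero_iff], ?_⟩
        rw [← mul_smul, aeval_mul_x, comp_assoc, mul_smul]
        simp [hm]
      · rintro a m ⟨p, hp, hm⟩
        refine ⟨p.comp (X + C 1), by rwa [Ne, comp_X_add_C_eq_zero_iff], ?_⟩
        rw [← mul_smul, aeval_mul_y, comp_assoc, mul_smul]
        simp [hm]
      · rintro g m ⟨p, hp, hm⟩
        exact ⟨p, hp, by rw [← mul_smul, aeval_mul_w hc, mul_smul, hm, smul_zero]⟩ }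

theorem exists_aeval_smul_eq_zero (hc : IsConjInvariant c) (R : RCA G D c) {M : Type}
    [AddCommGroup M] [Module R.H M] [Module ℂ M] [IsScalarTower ℂ R.H M] {n : ℕ} {m : M}
    (hm : m ∈ R.nilp M n) : ∃ Q : ℂ[X], Q ≠ 0 ∧ aeval R.eu Q • m = 0 := by
  induction n generalizing m with
  | zero => rw [(Submodule.mem_bot ℂ).1 hm]; exact ⟨1, one_ne_zero, smul_zero _⟩
  | succ n ih =>
    obtain ⟨Q, hQ, h⟩ : aeval R.eu R.lowPoly • m ∈ eulerFinite hc R M :=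
      lowPoly_smul_mem fun v => ih (hm v)
    exact ⟨Q * R.lowPoly, mul_ne_zero hQ R.lowPoly_ne_zero, by rw [map_mul, mul_smul, h]⟩

theorem y_smul_mem_genEig (v : V) {f : ℂ[X]} {m : M} (hm : m ∈ R.genEig M f) :
    R.y v • m ∈ R.genEig M (f.comp (X + C 1)) := by
  obtain ⟨k, hk⟩ := hm
  refine ⟨k, ?_⟩
  have e : (X + C (1 : ℂ)).comp (X + C (-1)) = X := by simp
  rw [← pow_comp, ← mul_smul, aeval_mul_y, comp_assoc, mul_smul, e, comp_X, hk, smul_zero]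

theorem eq_zero_of_mem_genEig {f g : ℂ[X]} (h : IsCoprime f g) {m : M}
    (hm : m ∈ R.genEig M f) (hg : aeval R.eu g • m = 0) : m = 0 := by
  obtain ⟨k, hk⟩ := hm
  exact eq_zero_of_isCoprime h.pow_left hk hg

theorem mem_nilp_of_mem_succ {j : ℕ} {f : ℂ[X]}
    (h : IsCoprime (f.comp (X + C (1 * (j : ℂ)))) R.lowPoly) {m : M}
    (hm : m ∈ R.genEig M f) (hj : m ∈ R.nilp M (j + 1)) : m ∈ R.nilp M j := by
  induction j generalizing f m with
  | zero =>
    have h1 : aeval R.eu R.lowPoly • m ∈ (⊥ : Submodule R.H M) := lowPoly_smul_mem fun v => hj v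
    have : m = 0 := eq_zero_of_mem_genEig (by simpa using h) hm h1
    rw [this]; exact zero_mem _
  | succ j ih =>
    intro v
    refine ih (f := f.comp (X + C 1)) ?_ (y_smul_mem_genEig v hm) (hj v)
    have e : (X + C (1 : ℂ)).comp (X + C (1 * (j : ℂ))) = X + C (1 * ((j + 1 : ℕ) : ℂ)) := by
      simp only [add_comp, X_comp, C_comp, Nat.cast_succ, one_mul, C_add]
      ring
    rwa [comp_assoc, e]

/-- The generalized eigenspaces of the Euler element are killed by a high power of `h`,
uniformly in the module. -/
theorem mem_nilp_of_mem_genEig {n : ℕ} {f : ℂ[X]}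
    (h : ∀ j : ℕ, n ≤ j → IsCoprime (f.comp (X + C (1 * (j : ℂ)))) R.lowPoly) {m : M}
    (hm : m ∈ R.genEig M f) (hj : ∃ k, m ∈ R.nilp M k) : m ∈ R.nilp M n := by
  obtain ⟨k, hk⟩ := hj
  induction k with
  | zero => exact nilp_mono (Nat.zero_le n) hk
  | succ k ih =>
    by_cases hnk : n ≤ k
    · exact ih (mem_nilp_of_mem_succ (h k hnk) hm hk)
    · exact nilp_mono (by omega) hk

end

end Modules

end RCA

namespace RCA

section Finiteness

open Polynomial

variable {V : Type} [AddCommGroup V] [Module ℂ V] [FiniteDimensional ℂ V]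
variable {G : CRG V} {D : ReflData G} {c : G.Refl → ℂ}
variable {R : RCA G D c} {M : Type} [AddCommGroup M] [Module R.H M]
  [Module ℂ M] [IsScalarTower ℂ R.H M]

theorem exists_fg_stable {n : ℕ} {U₀ : Submodule ℂ M} (hU : U₀.FG)
    (hw : ∀ g, ∀ m ∈ U₀, R.w g • m ∈ U₀) (hn : U₀ ≤ R.nilp M n) :
    ∃ U : Submodule ℂ M, U.FG ∧ U₀ ≤ U ∧ (∀ g, ∀ m ∈ U, R.w g • m ∈ U) ∧
      ∀ v, ∀ m ∈ U, R.y v • m ∈ U := by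
  induction n generalizing U₀ with
  | zero =>
    refine ⟨U₀, hU, le_rfl, hw, fun v m hm => ?_⟩
    rw [(Submodule.mem_bot ℂ).1 (hn hm), smul_zero]
    exact zero_mem _
  | succ n ih =>
    obtain ⟨U, h1, h2, h3, h4⟩ :=
      ih (U₀ := Submodule.map₂ (R.act M) (LinearMap.range R.y) U₀)
      (Submodule.FG.map₂ _ (Module.Finite.iff_fg.1 inferInstance) hU)
      (fun g => (Submodule.map₂_le (q := U₀)
        (r := (Submodule.map₂ (R.act M) (LinearMap.range R.y) U₀).comap (R.act M (R.w g)))).2 <| by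
        rintro _ ⟨v, rfl⟩ m hm
        change R.w g • R.y v • m ∈ Submodule.map₂ (R.act M) (LinearMap.range R.y) U₀
        rw [← mul_smul, R.w_y, mul_smul]
        exact Submodule.apply_mem_map₂ (R.act M) ⟨_, rfl⟩ (hw g m hm))
      (Submodule.map₂_le.2 <| by
        rintro _ ⟨v, rfl⟩ m hm
        exact hn hm v)
    refine ⟨U₀ ⊔ U, hU.sup h1, le_sup_left, fun g => ?_, fun v => ?_⟩
    · exact (sup_le (fun m hm => Submodule.mem_sup_left (hw g m hm))
        (fun m hm => Submodule.mem_sup_right (h3 g m hm)) :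
        U₀ ⊔ U ≤ (U₀ ⊔ U).comap (R.act M (R.w g)))
    · exact (sup_le (fun m hm => Submodule.mem_sup_right
          (h2 (Submodule.apply_mem_map₂ (R.act M) ⟨v, rfl⟩ hm)))
        (fun m hm => Submodule.mem_sup_right (h4 v m hm)) :
        U₀ ⊔ U ≤ (U₀ ⊔ U).comap (R.act M (R.y v)))

theorem exists_aeval_smul_eq_zero_of_fg (hc : IsConjInvariant c)
    (hM : ∀ m : M, ∃ n, m ∈ R.nilp M n) {U : Submodule ℂ M} (hU : U.FG) :
    ∃ Q : ℂ[X], Q ≠ 0 ∧ ∀ m ∈ U, aeval R.eu Q • m = 0 := by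
  induction U, hU using Submodule.fg_induction with
  | singleton m =>
    obtain ⟨n, hn⟩ := hM m
    obtain ⟨Q, hQ, h⟩ := exists_aeval_smul_eq_zero hc R hn
    refine ⟨Q, hQ, fun m' hm' => ?_⟩
    obtain ⟨r, rfl⟩ := Submodule.mem_span_singleton.1 hm'
    rw [smul_algebra_smul_comm, h, smul_zero]
  | sup U₁ U₂ _ _ h₁ h₂ =>
    obtain ⟨p, hp, h₁⟩ := h₁
    obtain ⟨q, hq, h₂⟩ := h₂
    refine ⟨p * q, mul_ne_zero hp hq, fun m hm => ?_⟩
    obtain ⟨a, ha, b, hb, rfl⟩ := Submodule.mem_sup.1 hm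
    rw [smul_add, aeval_smul_eq_zero_of_dvd (dvd_mul_right p q) (h₁ a ha),
      aeval_smul_eq_zero_of_dvd (dvd_mul_left q p) (h₂ b hb), add_zero]

theorem exists_fg_aeval_smul_mem (hc : IsConjInvariant c)
    (hM : ∀ m : M, ∃ n, m ∈ R.nilp M n) {U : Submodule ℂ M} (hU : U.FG) :
    ∃ U' : Submodule ℂ M, U'.FG ∧ ∀ m ∈ U, ∀ p : ℂ[X], aeval R.eu p • m ∈ U' := by
  obtain ⟨Q, hQ, h⟩ := exists_aeval_smul_eq_zero_of_fg hc hM hU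
  have hfg : (degreeLT ℂ Q.natDegree).FG :=
    Module.Finite.iff_fg.1 (Module.Finite.equiv (degreeLTEquiv ℂ Q.natDegree).symm)
  refine ⟨Submodule.map₂ (R.act M) ((degreeLT ℂ Q.natDegree).map (aeval R.eu).toLinearMap) U,
    Submodule.FG.map₂ _ (hfg.map _) hU, fun m hm p => ?_⟩
  have e : aeval R.eu p • m = aeval R.eu (p % Q) • m := by
    conv_lhs => rw [← EuclideanDomain.mod_add_div p Q, map_add, add_smul, mul_comm, map_mul,
      mul_smul, h m hm, smul_zero, add_zero]
  rw [e]
  refine Submodule.apply_mem_map₂ (R.act M) ⟨p % Q, ?_, rfl⟩ hm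
  rw [SetLike.mem_coe, mem_degreeLT, ← degree_eq_natDegree hQ]
  exact EuclideanDomain.mod_lt p hQ

theorem xPow_fg {U : Submodule ℂ M} (hU : U.FG) (n : ℕ) : (R.xPow M U n).FG := by
  induction n with
  | zero => exact hU
  | succ n ih => exact Submodule.FG.map₂ _ (Module.Finite.iff_fg.1 inferInstance) ih

theorem x_smul_mem_xPow {U : Submodule ℂ M} {n : ℕ} (a : Module.Dual ℂ V) {m : M}
    (hm : m ∈ R.xPow M U n) : R.x a • m ∈ R.xPow M U (n + 1) :=
  Submodule.apply_mem_map₂ (R.act M) ⟨a, rfl⟩ hm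

theorem w_smul_mem_xPow {U : Submodule ℂ M} (hw : ∀ g, ∀ m ∈ U, R.w g • m ∈ U) (n : ℕ) (g : G.W) :
    ∀ m ∈ R.xPow M U n, R.w g • m ∈ R.xPow M U n := by
  induction n with
  | zero => exact hw g
  | succ n ih =>
    refine (Submodule.map₂_le (r := (R.xPow M U (n + 1)).comap (R.act M (R.w g)))).2 ?_
    rintro _ ⟨a, rfl⟩ m hm
    change R.w g • R.x a • m ∈ R.xPow M U (n + 1)
    rw [← mul_smul, R.w_x, mul_smul]
    exact x_smul_mem_xPow _ (ih m hm)

theorem aeval_smul_xPow_eq_zero {U : Submodule ℂ M} {Q : ℂ[X]}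
    (hQ : ∀ m ∈ U, aeval R.eu Q • m = 0) (n : ℕ) :
    ∀ m ∈ R.xPow M U n, aeval R.eu (Q.comp (X + C (-1 * (n : ℂ)))) • m = 0 := by
  induction n with
  | zero => simpa [xPow] using hQ
  | succ n ih =>
    refine (Submodule.map₂_le (r := LinearMap.ker (R.act M _))).2 ?_
    rintro _ ⟨a, rfl⟩ m hm
    change aeval R.eu _ • R.x a • m = 0
    have e : (X + C (-1 * ((n + 1 : ℕ) : ℂ))).comp (X + C 1) = X + C (-1 * (n : ℂ)) := by
      simp only [add_comp, X_comp, C_comp, Nat.cast_succ, neg_mul, one_mul, C_add, C_neg, neg_comp]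
      ring
    rw [← mul_smul, aeval_mul_x, comp_assoc, e, mul_smul, ih m hm, smul_zero]

theorem y_smul_mem_iSup_xPow {U : Submodule ℂ M} (hw : ∀ g, ∀ m ∈ U, R.w g • m ∈ U)
    (hy : ∀ v, ∀ m ∈ U, R.y v • m ∈ U) (n : ℕ) (v : V) :
    ∀ m ∈ R.xPow M U n, R.y v • m ∈ ⨆ n, R.xPow M U n := by
  induction n with
  | zero => exact fun m hm => Submodule.mem_iSup_of_mem 0 (hy v m hm)
  | succ n ih =>
    refine (Submodule.map₂_le (r := (⨆ n, R.xPow M U n).comap (R.act M (R.y v)))).2 ?_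
    rintro _ ⟨a, rfl⟩ m hm
    change R.y v • R.x a • m ∈ ⨆ n, R.xPow M U n
    rw [← mul_smul, R.rel', add_smul, sub_smul, mul_smul, smul_assoc, one_smul, Finset.sum_smul]
    refine add_mem ?_ (Submodule.mem_iSup_of_mem n (sub_mem (Submodule.smul_mem _ _ hm)
      (sum_mem fun s _ => ?_)))
    · have h : (⨆ n, R.xPow M U n) ≤ (⨆ n, R.xPow M U n).comap (R.act M (R.x a)) :=
        iSup_le fun n m hm => Submodule.mem_iSup_of_mem (n + 1) (x_smul_mem_xPow a hm)
      exact h (ih m hm)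
    · rw [smul_assoc]
      exact Submodule.smul_mem _ _ (w_smul_mem_xPow hw n _ m hm)

theorem iSup_xPow_eq_top [Module.Finite R.H M] (hM : ∀ m : M, ∃ n, m ∈ R.nilp M n) :
    ∃ U : Submodule ℂ M, U.FG ∧ ⨆ n, R.xPow M U n = ⊤ := by
  obtain ⟨s, hs⟩ := Module.Finite.fg_top (R := R.H) (M := M)
  choose N hN using hM
  have hfin : (Set.image2 (fun g m => R.w g • m) Set.univ (s : Set M)).Finite :=
    (Set.toFinite _).image2 _ s.finite_toSet
  obtain ⟨U, h1, h2, h3, h4⟩ := exists_fg_stable (R := R) (n := s.sup N)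
    (U₀ := Submodule.span ℂ (Set.image2 (fun g m => R.w g • m) Set.univ (s : Set M)))
    (Submodule.fg_span hfin)
    (fun g => (Submodule.span_le (p := (Submodule.span ℂ _).comap (R.act M (R.w g)))).2 <| by
      rintro _ ⟨g', -, m, hm, rfl⟩
      refine Submodule.subset_span ⟨g * g', trivial, m, hm, ?_⟩
      change R.w (g * g') • m = R.w g • R.w g' • m
      rw [map_mul, mul_smul])
    (Submodule.span_le.2 <| by
      rintro _ ⟨g, -, m, hm, rfl⟩
      exact w_smul_mem_nilp g (nilp_mono (Finset.le_sup hm) (hN m)))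
  refine ⟨U, h1, ?_⟩
  have hstable := R.smul_mem_of_stable (⨆ n, R.xPow M U n)
    (fun a => (iSup_le fun n m hm => Submodule.mem_iSup_of_mem (n + 1) (x_smul_mem_xPow a hm) :
      (⨆ n, R.xPow M U n) ≤ (⨆ n, R.xPow M U n).comap (R.act M (R.x a))))
    (fun v => (iSup_le fun n m hm => y_smul_mem_iSup_xPow h3 h4 n v m hm :
      (⨆ n, R.xPow M U n) ≤ (⨆ n, R.xPow M U n).comap (R.act M (R.y v))))
    (fun g => (iSup_le fun n m hm => Submodule.mem_iSup_of_mem n (w_smul_mem_xPow h3 n g m hm) :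
      (⨆ n, R.xPow M U n) ≤ (⨆ n, R.xPow M U n).comap (R.act M (R.w g))))
  let T : Submodule R.H M :=
    { (⨆ n, R.xPow M U n) with smul_mem' := fun h m hm => hstable h m hm }
  have hT : T = ⊤ := by
    rw [eq_top_iff, ← hs, Submodule.span_le]
    intro m hm
    refine Submodule.mem_iSup_of_mem (p := R.xPow M U) 0 (h2 (Submodule.subset_span
      ⟨1, trivial, m, hm, ?_⟩))
    change R.w 1 • m = m
    rw [map_one, one_smul]
  rw [eq_top_iff]
  intro m _
  have : m ∈ T := hT ▸ Submodule.mem_top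
  exact this

theorem genEig_fg (hc : IsConjInvariant c) [Module.Finite R.H M]
    (hM : ∀ m : M, ∃ n, m ∈ R.nilp M n) {f : ℂ[X]} (hf : f ≠ 0) : (R.genEig M f).FG := by
  obtain ⟨U, hU, htop⟩ := iSup_xPow_eq_top hM
  obtain ⟨Q, hQ, hQU⟩ := exists_aeval_smul_eq_zero_of_fg hc hM hU
  obtain ⟨n₀, hn₀⟩ := exists_isCoprime_shift hQ hf (neg_ne_zero.2 one_ne_zero)
  set A : Submodule ℂ M := (Finset.range n₀).sup (R.xPow M U) with hA
  have hAfg : A.FG := Submodule.fg_finset_sup _ _ fun n _ => xPow_fg hU n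
  obtain ⟨A', hA'fg, hA'⟩ := exists_fg_aeval_smul_mem hc hM hAfg
  have key : ∀ m ∈ ⨆ n, R.xPow M U n,
      ∃ a ∈ A, ∃ p : ℂ[X], IsCoprime p f ∧ aeval R.eu p • (m - a) = 0 := by
    intro m hm
    induction hm using Submodule.iSup_induction' with
    | mem n m hm =>
      by_cases h : n < n₀
      · exact ⟨m, Finset.le_sup (f := R.xPow M U) (Finset.mem_range.2 h) hm, 1,
          isCoprime_one_left, by simp⟩
      · exact ⟨0, zero_mem _, _, hn₀ n (not_lt.1 h),
          by rw [sub_zero]; exact aeval_smul_xPow_eq_zero hQU n m hm⟩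
    | zero => exact ⟨0, zero_mem _, 1, isCoprime_one_left, by simp⟩
    | add m m' _ _ h h' =>
      obtain ⟨a, ha, p, hp, h⟩ := h
      obtain ⟨a', ha', p', hp', h'⟩ := h'
      refine ⟨a + a', add_mem ha ha', p * p', hp.mul_left hp', ?_⟩
      rw [add_sub_add_comm, smul_add, aeval_smul_eq_zero_of_dvd (dvd_mul_right p p') h,
        aeval_smul_eq_zero_of_dvd (dvd_mul_left p' p) h', add_zero]
  refine Submodule.FG.of_le hA'fg ?_
  rintro m ⟨k, hk⟩
  obtain ⟨a, ha, p, hp, h⟩ := key m (htop ▸ Submodule.mem_top)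
  obtain ⟨u, w, huw⟩ := hp.pow_right (n := k)
  have e : m = aeval R.eu (u * p) • a := by
    calc m = aeval R.eu (u * p + w * f ^ k) • m := by rw [huw, map_one, one_smul]
      _ = aeval R.eu u • aeval R.eu p • m := by
        rw [map_add, map_mul, map_mul, add_smul, mul_smul, mul_smul, hk, smul_zero, add_zero]
      _ = aeval R.eu (u * p) • a := by
        rw [smul_sub, sub_eq_zero] at h
        rw [h, map_mul, mul_smul]
  rw [e]
  exact hA' a ha _

theorem exists_mem_genEig_of_lt (hc : IsConjInvariant c) (hM : ∀ m : M, ∃ n, m ∈ R.nilp M n)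
    {N N' : Submodule R.H M} (h : N < N') : ∃ m ∈ N', m ∉ N ∧ m ∈ R.genEig M R.lowPoly := by
  obtain ⟨m, hm, hmN⟩ := SetLike.exists_of_lt h
  obtain ⟨m, hm, hmN, hy⟩ : ∃ m ∈ N', m ∉ N ∧ ∀ v, R.y v • m ∈ N := by
    obtain ⟨n, hn⟩ := hM m
    induction n generalizing m with
    | zero => exact absurd ((Submodule.mem_bot ℂ).1 hn ▸ zero_mem _) hmN
    | succ n ih =>
      by_cases hv : ∀ v, R.y v • m ∈ N
      · exact ⟨m, hm, hmN, hv⟩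
      · push Not at hv
        obtain ⟨v, hv⟩ := hv
        exact ih _ (N'.smul_mem _ hm) hv (hn v)
  obtain ⟨n, hn⟩ := hM m
  obtain ⟨Q, hQ, hQm⟩ := exists_aeval_smul_eq_zero hc R hn
  obtain ⟨k, A, B, rfl, hA, hB⟩ := exists_mul_dvd_pow_isCoprime R.lowPoly hQ
  refine ⟨aeval R.eu B • m, N'.smul_mem _ hm, fun hBm => hmN ?_, k, ?_⟩
  · exact mem_of_isCoprime hB hBm (lowPoly_smul_mem hy)
  · exact aeval_smul_eq_zero_of_dvd hA (by rwa [← mul_smul, ← map_mul])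

theorem isFiniteLength (hc : IsConjInvariant c) [Module.Finite R.H M]
    (hM : ∀ m : M, ∃ n, m ∈ R.nilp M n) : IsFiniteLength R.H M := by
  let E := R.genEig M R.lowPoly
  have : Module.Finite ℂ E := Module.Finite.iff_fg.2 (genEig_fg hc hM R.lowPoly_ne_zero)
  let F : Submodule R.H M → Submodule ℂ E := fun N => (N.restrictScalars ℂ).comap E.subtype
  have hF : StrictMono F := fun N N' h => by
    obtain ⟨m, hm, hmN, hmE⟩ := exists_mem_genEig_of_lt hc hM h
    exact SetLike.lt_iff_le_and_exists.2 ⟨fun x hx => h.le hx, ⟨m, hmE⟩, hm, hmN⟩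
  exact isFiniteLength_iff_isNoetherian_isArtinian.2
    ⟨isNoetherian_iff'.2 hF.wellFoundedGT, hF.wellFoundedLT⟩

theorem exists_mem_genEig_apply_eq (hc : IsConjInvariant c) {N : Type} [AddCommGroup N]
    [Module R.H N] [Module ℂ N] [IsScalarTower ℂ R.H N] (hM : ∀ m : M, ∃ n, m ∈ R.nilp M n)
    (e : M →ₗ[R.H] N) (he : Function.Surjective e) {f : ℂ[X]} {v : N} (hv : v ∈ R.genEig N f) :
    ∃ m ∈ R.genEig M f, e m = v := by
  obtain ⟨m, rfl⟩ := he v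
  obtain ⟨j, hj⟩ := hv
  obtain ⟨n, hn⟩ := hM m
  obtain ⟨Q, hQ, hQm⟩ := exists_aeval_smul_eq_zero hc R hn
  obtain ⟨k, A, B, rfl, hA, hB⟩ := exists_mul_dvd_pow_isCoprime f hQ
  obtain ⟨u, w, huw⟩ := hB.pow_right (n := j)
  refine ⟨aeval R.eu u • aeval R.eu B • m, ⟨k, ?_⟩, ?_⟩
  · rw [aeval_smul_comm, aeval_smul_eq_zero_of_dvd hA (by rwa [← mul_smul, ← map_mul]), smul_zero]
  · calc e (aeval R.eu u • aeval R.eu B • m) = aeval R.eu (u * B + w * f ^ j) • e m := by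
          rw [map_add, map_mul, map_mul, add_smul, mul_smul, mul_smul, hj, smul_zero, add_zero,
            map_smul, map_smul]
      _ = e m := by rw [huw, map_one, one_smul]

end Finiteness

end RCA

namespace RCA

section Category

open Polynomial CategoryTheory

variable {V : Type} [AddCommGroup V] [Module ℂ V] [FiniteDimensional ℂ V]
variable {G : CRG V} {D : ReflData G} {c : G.Refl → ℂ} {R : RCA G D c}

noncomputable instance (A : CatO R) : Module ℂ A.M := Module.compHom A.M (algebraMap ℂ R.H)

instance (A : CatO R) : IsScalarTower ℂ R.H A.M :=
  ⟨fun r h m => by rw [Algebra.smul_def, mul_smul]; rfl⟩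

instance (A : CatO R) : Module.Finite R.H A.M := A.fg

theorem exists_mem_nilp (A : CatO R) (m : A.M) : ∃ n, m ∈ R.nilp A.M n :=
  (A.locNilp m).imp fun _ h => mem_nilp_iff.2 h

/-- The quotient of an object of the category by a submodule. -/
def quotObj (A : CatO R) (N : Submodule R.H A.M) : CatO R where
  M := A.M ⧸ N
  locNilp m := by
    obtain ⟨m, rfl⟩ := N.mkQ_surjective m
    obtain ⟨n, hn⟩ := A.locNilp m
    exact ⟨n, fun L hL => by rw [← map_smul, hn L hL, map_zero]⟩
  fg := inferInstance

theorem surjective_of_epi {A B : CatO R} (e : A ⟶ B) [Epi e] :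
    Function.Surjective (show A.M →ₗ[R.H] B.M from e) := by
  let e' : A.M →ₗ[R.H] B.M := e
  let π : B ⟶ quotObj B (LinearMap.range e') := (LinearMap.range e').mkQ
  let z : B ⟶ quotObj B (LinearMap.range e') := (0 : B.M →ₗ[R.H] B.M ⧸ LinearMap.range e')
  have h : e ≫ π = e ≫ z := (LinearMap.range_mkQ_comp e').trans (LinearMap.zero_comp e').symm
  have h2 : (LinearMap.range e').mkQ = 0 := (cancel_epi e).1 h
  rw [← LinearMap.range_eq_top, ← Submodule.ker_mkQ (LinearMap.range e'), h2, LinearMap.ker_zero]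

theorem epi_of_surjective {A B : CatO R} (e : A.M →ₗ[R.H] B.M) (he : Function.Surjective e) :
    Epi (show A ⟶ B from e) :=
  ⟨fun g h w => (LinearMap.cancel_right (f := (show B.M →ₗ[R.H] _ from g))
    (f' := (show B.M →ₗ[R.H] _ from h)) he).1 w⟩

/-- Products of `n` elements of `h`. -/
def yWords (R : RCA G D c) (n : ℕ) : Set R.H :=
  {u | ∃ L : List V, L.length = n ∧ (L.map fun v => R.y v).prod = u}

theorem exists_mem_nilp_quotient {n : ℕ} {J : Submodule R.H R.H} (hJ : R.yWords n ⊆ J)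
    (m : R.H ⧸ J) : ∃ N, m ∈ R.nilp (R.H ⧸ J) N := by
  obtain ⟨h, rfl⟩ := J.mkQ_surjective m
  have h1 : J.mkQ h = h • J.mkQ 1 := by rw [← map_smul, smul_eq_mul, mul_one]
  rw [h1]
  refine smul_mem_iSup_nilp h ⟨n, mem_nilp_iff.2 fun L hL => ?_⟩
  rw [← map_smul, smul_eq_mul, mul_one]
  exact (Submodule.Quotient.mk_eq_zero J).2 (hJ ⟨L, hL, rfl⟩)

/-- The object `(H_c / J)^r`, for a left ideal `J` containing all products of `n` elements
of `h`. -/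
def powObj (r : ℕ) {n : ℕ} (J : Submodule R.H R.H) (hJ : R.yWords n ⊆ J) : CatO R where
  M := Fin r → R.H ⧸ J
  locNilp m := by
    choose N hN using fun i => exists_mem_nilp_quotient hJ (m i)
    refine ⟨Finset.univ.sup N, fun L hL => funext fun i => ?_⟩
    exact mem_nilp_iff.1 (nilp_mono (Finset.le_sup (Finset.mem_univ i)) (hN i)) L hL
  fg := inferInstance

theorem span_le_ker_toSpanSingleton {A : CatO R} {S : Set R.H} {m : A.M}
    (h : ∀ u ∈ S, u • m = 0) :
    Submodule.span R.H S ≤ LinearMap.ker (LinearMap.toSpanSingleton R.H A.M m) :=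
  Submodule.span_le.2 h

theorem exists_pow_smul_eq_zero (hc : IsConjInvariant c) (R : RCA G D c) (n : ℕ) (f : ℂ[X]) :
    ∃ k, ∀ (A : CatO R) (m : A.M), m ∈ R.nilp A.M n → m ∈ R.genEig A.M f →
      aeval R.eu (f ^ k) • m = 0 := by
  obtain ⟨N, hN⟩ := exists_mem_nilp_quotient (Submodule.subset_span (R := R.H) (s := R.yWords n))
    (Submodule.Quotient.mk 1)
  obtain ⟨Q, hQ, h⟩ := exists_aeval_smul_eq_zero hc R hN
  rw [← Submodule.Quotient.mk_smul, smul_eq_mul, mul_one, Submodule.Quotient.mk_eq_zero] at h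
  obtain ⟨k, A, B, rfl, hA, hB⟩ := exists_mul_dvd_pow_isCoprime f hQ
  refine ⟨k, fun E m hm ⟨j, hj⟩ => aeval_smul_eq_zero_of_dvd hA ?_⟩
  have h0 : aeval R.eu (A * B) • m = 0 := span_le_ker_toSpanSingleton (by
    rintro _ ⟨L, hL, rfl⟩
    exact mem_nilp_iff.1 hm L hL) h
  refine eq_zero_of_isCoprime (hB.pow_right (n := j)) (e := R.eu) ?_ ?_
  · rwa [← mul_smul, ← map_mul, mul_comm]
  · rw [aeval_smul_comm, hj, smul_zero]

/-- The left ideal generated by the products of `n` elements of `h` and a polynomial in the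
Euler element. -/
noncomputable def truncIdeal (R : RCA G D c) (n : ℕ) (p : ℂ[X]) : Submodule R.H R.H :=
  Submodule.span R.H (R.yWords n ∪ {aeval R.eu p})

theorem yWords_subset_truncIdeal (n : ℕ) (p : ℂ[X]) :
    R.yWords n ⊆ R.truncIdeal n p :=
  Set.subset_union_left.trans Submodule.subset_span

/-- The map out of `(H_c / J)^r` determined by the images of the generators. -/
noncomputable def powLift {A : CatO R} {r n : ℕ} {p : ℂ[X]} (m : Fin r → A.M)
    (hn : ∀ i, m i ∈ R.nilp A.M n) (hp : ∀ i, aeval R.eu p • m i = 0) :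
    (Fin r → R.H ⧸ R.truncIdeal n p) →ₗ[R.H] A.M :=
  LinearMap.lsum R.H (fun _ => R.H ⧸ R.truncIdeal n p) ℕ fun i =>
    (R.truncIdeal n p).liftQ (LinearMap.toSpanSingleton R.H A.M (m i))
      (span_le_ker_toSpanSingleton (by
        rintro _ (⟨L, hL, rfl⟩ | rfl)
        · exact mem_nilp_iff.1 (hn i) L hL
        · exact hp i))

theorem powLift_single {A : CatO R} {r n : ℕ} {p : ℂ[X]} (m : Fin r → A.M)
    (hn : ∀ i, m i ∈ R.nilp A.M n) (hp : ∀ i, aeval R.eu p • m i = 0) (i : Fin r) :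
    powLift m hn hp (Pi.single i (Submodule.Quotient.mk 1)) = m i := by
  rw [powLift, LinearMap.lsum_piSingle]
  exact one_smul R.H (m i)

theorem pow_hom_ext {M : Type} [AddCommGroup M] [Module R.H M] {r : ℕ} {J : Submodule R.H R.H}
    {g h : (Fin r → R.H ⧸ J) →ₗ[R.H] M}
    (H : ∀ i, g (Pi.single i (Submodule.Quotient.mk 1)) =
      h (Pi.single i (Submodule.Quotient.mk 1))) : g = h := by
  refine LinearMap.pi_ext' fun i => ?_
  ext
  exact H i

theorem projective_powObj (hc : IsConjInvariant c) (r : ℕ) {n k : ℕ} {f : ℂ[X]}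
    (hn : ∀ j : ℕ, n ≤ j → IsCoprime (f.comp (X + C (1 * (j : ℂ)))) R.lowPoly)
    (hk : ∀ (A : CatO R) (m : A.M), m ∈ R.nilp A.M n → m ∈ R.genEig A.M f →
      aeval R.eu (f ^ k) • m = 0) :
    Projective (powObj r (R.truncIdeal n (f ^ k)) (yWords_subset_truncIdeal n (f ^ k))) where
  factors {E X} φ e _ := by
    let φ' : (Fin r → R.H ⧸ R.truncIdeal n (f ^ k)) →ₗ[R.H] X.M := φ
    let e' : E.M →ₗ[R.H] X.M := e
    have hφ : ∀ i, φ' (Pi.single i (Submodule.Quotient.mk 1)) ∈ R.genEig X.M f := fun i => by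
      refine ⟨k, ?_⟩
      rw [← map_smul, ← Pi.single_smul, ← Submodule.Quotient.mk_smul, smul_eq_mul, mul_one,
        (Submodule.Quotient.mk_eq_zero (R.truncIdeal n (f ^ k))).2
          (Submodule.subset_span (Or.inr rfl)), Pi.single_zero, map_zero]
    choose m hm hem using fun i =>
      exists_mem_genEig_apply_eq hc (exists_mem_nilp E) e' (surjective_of_epi e) (hφ i)
    have hmn : ∀ i, m i ∈ R.nilp E.M n := fun i =>
      mem_nilp_of_mem_genEig hn (hm i) (exists_mem_nilp E _)
    refine ⟨powLift m hmn fun i => hk E _ (hmn i) (hm i), ?_⟩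
    refine pow_hom_ext (g := e' ∘ₗ powLift m hmn fun i => hk E _ (hmn i) (hm i)) (h := φ')
      fun i => ?_
    rw [LinearMap.comp_apply, powLift_single, hem]

theorem enoughProjectives (hc : IsConjInvariant c) (R : RCA G D c) :
    EnoughProjectives (CatO R) where
  presentation A := by
    obtain ⟨r, s, hs⟩ := Module.Finite.exists_fin (R := R.H) (M := A.M)
    choose N hN using exists_mem_nilp A
    choose Q hQ hQs using fun i => exists_aeval_smul_eq_zero hc R (hN (s i))
    have hf : ∏ i, Q i ≠ 0 := Finset.prod_ne_zero_iff.2 fun i _ => hQ i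
    obtain ⟨n, hn⟩ := exists_isCoprime_shift hf R.lowPoly_ne_zero one_ne_zero
    obtain ⟨k, hk⟩ := exists_pow_smul_eq_zero hc R n (∏ i, Q i)
    have hsf : ∀ i, s i ∈ R.genEig A.M (∏ i, Q i) := fun i =>
      ⟨1, by rw [pow_one]; exact
        aeval_smul_eq_zero_of_dvd (Finset.dvd_prod_of_mem Q (Finset.mem_univ i)) (hQs i)⟩
    have hsn : ∀ i, s i ∈ R.nilp A.M n := fun i =>
      mem_nilp_of_mem_genEig hn (hsf i) (exists_mem_nilp A _)
    have hsk := fun i => hk A _ (hsn i) (hsf i)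
    have hsurj : Function.Surjective (powLift s hsn hsk) := by
      rw [← LinearMap.range_eq_top, eq_top_iff, ← hs, Submodule.span_le]
      rintro _ ⟨i, rfl⟩
      exact ⟨_, powLift_single s hsn hsk i⟩
    refine ⟨{ p := powObj r (R.truncIdeal n ((∏ i, Q i) ^ k)) (yWords_subset_truncIdeal n _)
              projective := projective_powObj hc r hn hk
              f := powLift s hsn hsk
              epi := epi_of_surjective (A := powObj r _ (yWords_subset_truncIdeal n _))
                (powLift s hsn hsk) hsurj }⟩

end Category

end RCA

section Stmt4
noncomputable section

variable {V : Type} [AddCommGroup V] [Module ℂ V] [FiniteDimensional ℂ V]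
variable {G : CRG V} {D : ReflData G} {c : G.Refl → ℂ}

/-- **Finiteness properties of category 𝒪** (GGOR).
The category `𝒪_c(W)` has enough projectives, and every object of `𝒪_c(W)`
has finite length. -/
theorem catO_enoughProjectives_and_finiteLength
    (hc : IsConjInvariant c) (R : RCA G D c) :
    CategoryTheory.EnoughProjectives (CatO R) ∧
      ∀ A : CatO R, IsFiniteLength R.H A.M := by
  exact ⟨RCA.enoughProjectives hc R, fun A => RCA.isFiniteLength hc (RCA.exists_mem_nilp A)⟩

end
end Stmt4
end
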